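/- For every η > 0 there exists a constant C > 0 such that for all T ≥ 2, the number of hyperbolic matrices γ ∈ Γ_T for which |ε_γ| is not the fundamental unit of O_K (i.e. for which there exists a unit λ of O_K with 1 < λ < |ε_γ|) is at most C·T^{3/2+η}. Equivalently, ℙ_T(|Tr(γ)| > 2 and |ε_γ| = ε_K) = 1 − O(T^{−1/2+η}). -/

import Mathlib

noncomputable section

open Matrix Filter Topology

/-- `Γ = SL(2,ℤ)`. -/
abbrev SL2Z := Matrix.SpecialLinearGroup (Fin 2) ℤ

/-- Frobenius norm of a matrix in `SL(2,ℤ)`. -/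
noncomputable def frobNorm (γ : SL2Z) : ℝ :=
  Real.sqrt ((γ 0 0 ^ 2 + γ 0 1 ^ 2 + γ 1 0 ^ 2 + γ 1 1 ^ 2 : ℤ) : ℝ)

/-- Trace of a matrix in `SL(2,ℤ)`. -/
def trZ (γ : SL2Z) : ℤ := γ 0 0 + γ 1 1

/-- The absolute value `|ε_γ| = (|Tr γ| + √(Tr(γ)²-4))/2` of the large eigenvalue of a
hyperbolic matrix. -/
noncomputable def epsAbs (γ : SL2Z) : ℝ :=
  ((|trZ γ| : ℝ) + Real.sqrt ((trZ γ : ℝ) ^ 2 - 4)) / 2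

/-- `x` is a unit of the ring of integers of the real quadratic field
`K = ℚ(√(Tr(γ)²-4))`, viewed inside `ℝ`. -/
def IsUnitOfOK (γ : SL2Z) (x : ℝ) : Prop :=
  x ∈ IntermediateField.adjoin ℚ {Real.sqrt ((trZ γ : ℝ) ^ 2 - 4)} ∧
    IsIntegral ℤ x ∧ IsIntegral ℤ x⁻¹

/-- `|ε_γ|` is not the fundamental unit: some unit of `O_K` lies strictly between `1`
and `|ε_γ|`. -/
def NotFund (γ : SL2Z) : Prop :=
  ∃ lam : ℝ, IsUnitOfOK γ lam ∧ 1 < lam ∧ lam < epsAbs γ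

open Polynomial in
/-- An irrational integral real number annihilated by a monic rational quadratic has
integral trace and norm. -/
lemma exists_int_coeff_of_quadratic {x : ℝ} (hx : IsIntegral ℤ x) (hirr : Irrational x)
    {b c : ℚ} (h : x ^ 2 - b * x + c = 0) : ∃ m n : ℤ, b = m ∧ c = n := by
  have hxQ : IsIntegral ℚ x := hx.tower_top
  have hmin : minpoly ℚ x = (minpoly ℤ x).map (algebraMap ℤ ℚ) :=
    minpoly.isIntegrallyClosed_eq_field_fractions' ℚ hx
  have hQ : (X ^ 2 - C b * X + C c : ℚ[X]) = minpoly ℚ x := by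
    have hdeg : (X ^ 2 - C b * X + C c : ℚ[X]).natDegree = 2 := by compute_degree!
    have hmon : (X ^ 2 - C b * X + C c : ℚ[X]).Monic := by monicity!
    refine eq_of_monic_of_dvd_of_natDegree_le (minpoly.monic hxQ) hmon
      (minpoly.dvd ℚ x (by simpa using h)) ?_
    rw [hdeg, minpoly.two_le_natDegree_iff hxQ]
    rintro ⟨q, hq⟩
    exact hirr ⟨q, by simpa using hq⟩
  have h1 := congrArg (fun P => P.coeff 1) (hQ.trans hmin)
  have h0 := congrArg (fun P => P.coeff 0) (hQ.trans hmin)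
  simp [coeff_X, coeff_C] at h1 h0
  exact ⟨-(minpoly ℤ x).coeff 1, (minpoly ℤ x).coeff 0, by push_cast; linarith, h0⟩

/-- Elements of `ℚ(r)` with `r² ∈ ℚ` have the form `p + q r`. -/
lemma exists_rat_add_mul_of_mem_adjoin {r x : ℝ} {D : ℚ} (hr : r ^ 2 = D)
    (hx : x ∈ IntermediateField.adjoin ℚ {r}) : ∃ p q : ℚ, x = p + q * r := by
  have hint : IsAlgebraic ℚ r := by
    refine IsIntegral.isAlgebraic ⟨Polynomial.X ^ 2 - Polynomial.C D,
      Polynomial.monic_X_pow_sub_C D (by norm_num), ?_⟩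
    simp [hr]
  rw [← IntermediateField.mem_toSubalgebra,
    IntermediateField.adjoin_simple_toSubalgebra_of_isAlgebraic hint] at hx
  induction hx using Algebra.adjoin_induction with
  | mem y hy => exact ⟨0, 1, by simpa using hy⟩
  | algebraMap y => exact ⟨y, 0, by simp⟩
  | add y z _ _ hy hz =>
    obtain ⟨p, q, rfl⟩ := hy
    obtain ⟨p', q', rfl⟩ := hz
    exact ⟨p + p', q + q', by push_cast; ring⟩
  | mul y z _ _ hy hz =>
    obtain ⟨p, q, rfl⟩ := hy
    obtain ⟨p', q', rfl⟩ := hz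
    exact ⟨p * p' + q * q' * D, p * q' + p' * q, by push_cast; rw [← hr]; ring⟩

lemma irrational_of_isIntegral_inv {x : ℝ} (hx : IsIntegral ℤ x⁻¹) (h1 : 1 < x) :
    Irrational x := by
  rintro ⟨q, rfl⟩
  have hq : IsIntegral ℤ (q⁻¹ : ℚ) := by
    have : IsIntegral ℤ (algebraMap ℚ ℝ q⁻¹) := by simpa using hx
    exact (isIntegral_algebraMap_iff (algebraMap ℚ ℝ).injective).1 this
  obtain ⟨n, hn⟩ := IsIntegrallyClosed.isIntegral_iff.1 hq
  have hn' : (n : ℝ) = (q : ℝ)⁻¹ := by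
    have : (n : ℚ) = q⁻¹ := by simpa using hn
    exact_mod_cast congrArg (fun z : ℚ => (z : ℝ)) this
  have h2 : (q : ℝ)⁻¹ < 1 := inv_lt_one_of_one_lt₀ h1
  have h3 : 0 < (q : ℝ)⁻¹ := by positivity
  rw [← hn'] at h2 h3
  norm_cast at h2 h3
  omega

/-- The unit of norm `e` and trace `s` which exceeds one, if there is any. -/
def quadUnit (s e : ℤ) : ℝ := (s + √((s : ℝ) ^ 2 - 4 * e)) / 2

lemma eq_quadUnit {x : ℝ} (h1 : 1 < x) {s e : ℤ} (he : e = 1 ∨ e = -1)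
    (h : x ^ 2 - s * x + e = 0) : x = quadUnit s e := by
  have hpos : 0 ≤ 2 * x - s := by
    have : x * (2 * x - s) = x ^ 2 - e := by linarith
    have h2 : (e : ℝ) ≤ 1 := by rcases he with rfl | rfl <;> norm_num
    by_contra! hneg
    nlinarith
  have hs : √((s : ℝ) ^ 2 - 4 * e) = 2 * x - s := by
    rw [show (s : ℝ) ^ 2 - 4 * e = (2 * x - s) ^ 2 by linarith, Real.sqrt_sq hpos]
  rw [quadUnit, hs]
  ring

lemma IsUnitOfOK.exists_quadratic {γ : SL2Z} (hγ : 2 < |trZ γ|) {x : ℝ} (hx : IsUnitOfOK γ x)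
    (h1 : 1 < x) : ∃ s e : ℤ, (e = 1 ∨ e = -1) ∧ x ^ 2 - s * x + e = 0 := by
  obtain ⟨hmem, hint, hinv⟩ := hx
  have hirr := irrational_of_isIntegral_inv hinv h1
  have ht : (0 : ℝ) ≤ (trZ γ : ℝ) ^ 2 - 4 := by
    have : (2 : ℝ) < |(trZ γ : ℝ)| := by exact_mod_cast hγ
    nlinarith [sq_abs (trZ γ : ℝ)]
  have hr : √((trZ γ : ℝ) ^ 2 - 4) ^ 2 = (((trZ γ : ℚ) ^ 2 - 4 : ℚ) : ℝ) := by
    rw [Real.sq_sqrt ht]; push_cast; ring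
  obtain ⟨p, q, hpq⟩ := exists_rat_add_mul_of_mem_adjoin hr hmem
  have hquad : ∃ b c : ℚ, x ^ 2 - b * x + c = 0 := by
    refine ⟨2 * p, p ^ 2 - ((trZ γ : ℚ) ^ 2 - 4) * q ^ 2, ?_⟩
    push_cast at hr ⊢
    rw [← hr, hpq]
    ring
  obtain ⟨b, c, hbc⟩ := hquad
  obtain ⟨m, n, rfl, rfl⟩ := exists_int_coeff_of_quadratic hint hirr hbc
  have hx0 : x ≠ 0 := by positivity
  have hn0 : (n : ℝ) ≠ 0 := by
    intro h0
    apply hirr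
    have h2 : x * (x - m) = 0 := by push_cast at hbc; rw [h0] at hbc; linarith
    refine ⟨m, ?_⟩
    rcases mul_eq_zero.1 h2 with h | h
    · exact absurd h hx0
    · push_cast; linarith
  have hbc' : x⁻¹ ^ 2 - ((m / n : ℚ) : ℝ) * x⁻¹ + ((1 / n : ℚ) : ℝ) = 0 := by
    push_cast at hbc ⊢
    field_simp
    linarith
  obtain ⟨m', n', -, hn'⟩ := exists_int_coeff_of_quadratic hinv hirr.inv hbc'
  have hnn : n * n' = 1 := by
    have hn0' : (n : ℚ) ≠ 0 := by exact_mod_cast hn0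
    have : (n : ℚ) * n' = 1 := by rw [← hn']; field_simp
    exact_mod_cast this
  refine ⟨m, n, ?_, by simpa using hbc⟩
  exact Int.eq_one_or_neg_one_of_mul_eq_one hnn

lemma IsUnitOfOK.mul {γ : SL2Z} {x y : ℝ} (hx : IsUnitOfOK γ x) (hy : IsUnitOfOK γ y) :
    IsUnitOfOK γ (x * y) :=
  ⟨mul_mem hx.1 hy.1, hx.2.1.mul hy.2.1, by rw [mul_inv]; exact hx.2.2.mul hy.2.2⟩

lemma IsUnitOfOK.inv {γ : SL2Z} {x : ℝ} (hx : IsUnitOfOK γ x) : IsUnitOfOK γ x⁻¹ :=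
  ⟨inv_mem hx.1, hx.2.2, by rw [inv_inv]; exact hx.2.1⟩

lemma IsUnitOfOK.pow {γ : SL2Z} {x : ℝ} (hx : IsUnitOfOK γ x) (n : ℕ) :
    IsUnitOfOK γ (x ^ n) :=
  ⟨pow_mem hx.1 n, hx.2.1.pow n, by rw [← inv_pow]; exact hx.2.2.pow n⟩

lemma epsAbs_facts {γ : SL2Z} (hγ : 2 < |trZ γ|) :
    1 < epsAbs γ ∧ epsAbs γ + (epsAbs γ)⁻¹ = |(trZ γ : ℝ)| := by
  have h : (2 : ℝ) < |(trZ γ : ℝ)| := by exact_mod_cast hγ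
  have ht : (0 : ℝ) ≤ (trZ γ : ℝ) ^ 2 - 4 := by nlinarith [sq_abs (trZ γ : ℝ)]
  have hs := Real.sq_sqrt ht
  have hs0 := Real.sqrt_nonneg ((trZ γ : ℝ) ^ 2 - 4)
  have h1 : 1 < epsAbs γ := by rw [epsAbs]; linarith
  refine ⟨h1, ?_⟩
  have h0 : epsAbs γ ≠ 0 := by positivity
  have hq : epsAbs γ * (|(trZ γ : ℝ)| - epsAbs γ) = 1 := by
    rw [epsAbs]; nlinarith [sq_abs (trZ γ : ℝ)]
  have : (epsAbs γ)⁻¹ = |(trZ γ : ℝ)| - epsAbs γ :=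
    inv_eq_of_mul_eq_one_right hq
  linarith

lemma isIntegral_of_int_quadratic {x : ℝ} {m : ℤ} (h : x ^ 2 - m * x + 1 = 0) :
    IsIntegral ℤ x := by
  refine ⟨Polynomial.X ^ 2 - (Polynomial.C m * Polynomial.X) + 1, by monicity!, ?_⟩
  simpa [Polynomial.eval₂_mul, Polynomial.eval₂_C, -eq_intCast] using h

lemma isUnitOfOK_epsAbs {γ : SL2Z} (hγ : 2 < |trZ γ|) : IsUnitOfOK γ (epsAbs γ) := by
  obtain ⟨h1, h2⟩ := epsAbs_facts hγ
  have h0 : epsAbs γ ≠ 0 := by positivity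
  have hm : ((|trZ γ| : ℤ) : ℝ) = epsAbs γ + (epsAbs γ)⁻¹ := by rw [h2]; push_cast; rfl
  refine ⟨?_, isIntegral_of_int_quadratic (m := |trZ γ|) ?_,
    isIntegral_of_int_quadratic (m := |trZ γ|) ?_⟩
  · rw [epsAbs]
    have hmem : ((|trZ γ| : ℤ) : ℝ) ∈
        IntermediateField.adjoin ℚ {√((trZ γ : ℝ) ^ 2 - 4)} := intCast_mem _ _
    push_cast at hmem
    have htwo : (2 : ℝ) ∈ IntermediateField.adjoin ℚ {√((trZ γ : ℝ) ^ 2 - 4)} :=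
      ofNat_mem _ 2
    exact div_mem (add_mem hmem (IntermediateField.mem_adjoin_simple_self ℚ _)) htwo
  · rw [hm]; field_simp; ring
  · rw [hm]; field_simp; ring

/-- A norm `±1` quadratic unit exceeding one exceeds `√2`, and bounds its trace. -/
lemma quadratic_unit_bounds {x : ℝ} (h1 : 1 < x) {s e : ℤ} (he : e = 1 ∨ e = -1)
    (h : x ^ 2 - s * x + e = 0) : 2 < x ^ 2 ∧ 0 ≤ s ∧ (s : ℝ) ≤ 2 * x := by
  have key : x * (x - s) = -e := by linarith
  rcases he with rfl | rfl <;> push_cast at h key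
  · have h3 : (3 : ℝ) ≤ s := by
      have : (2 : ℝ) < s := by nlinarith [sq_nonneg (x - 1)]
      have : (2 : ℤ) < s := by exact_mod_cast this
      exact_mod_cast this
    refine ⟨by nlinarith, by exact_mod_cast (by linarith : (0 : ℝ) ≤ s), by nlinarith⟩
  · have h3 : (1 : ℝ) ≤ s := by
      have : (0 : ℝ) < s := by nlinarith
      have : (0 : ℤ) < s := by exact_mod_cast this
      exact_mod_cast this
    refine ⟨by nlinarith, by exact_mod_cast (by linarith : (0 : ℝ) ≤ s), by nlinarith⟩

/-- If `|ε_γ|` is not fundamental, it is a proper power of a smaller quadratic unit. -/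
lemma NotFund.exists_pow {γ : SL2Z} (hγ : 2 < |trZ γ|) (h : NotFund γ) :
    ∃ x : ℝ, ∃ s e : ℤ, ∃ k : ℕ, 1 < x ∧ (e = 1 ∨ e = -1) ∧ x ^ 2 - s * x + e = 0 ∧
      2 ≤ k ∧ epsAbs γ = x ^ k := by
  obtain ⟨hε1, -⟩ := epsAbs_facts hγ
  have hεU := isUnitOfOK_epsAbs hγ
  obtain ⟨y, hyU, hy1, hyε⟩ := h
  set S : Set ℝ := {x | IsUnitOfOK γ x ∧ 1 < x ∧ x < epsAbs γ} with hS
  have hfin : S.Finite := by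
    refine ((((Finset.Icc (0 : ℤ) ⌊2 * epsAbs γ⌋) ×ˢ ({1, -1} : Finset ℤ)).finite_toSet).image
      (fun p => quadUnit p.1 p.2)).subset ?_
    rintro x ⟨hxU, hx1, hxε⟩
    obtain ⟨s, e, he, hq⟩ := hxU.exists_quadratic hγ hx1
    obtain ⟨-, hs0, hs⟩ := quadratic_unit_bounds hx1 he hq
    refine ⟨(s, e), ?_, (eq_quadUnit hx1 he hq).symm⟩
    have : s ≤ ⌊2 * epsAbs γ⌋ := Int.le_floor.2 (by linarith)
    simp [hs0, this, he]
  obtain ⟨x, ⟨hxU, hx1, hxε⟩, hmin⟩ := hfin.exists_minimal ⟨y, hyU, hy1, hyε⟩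
  obtain ⟨s, e, he, hq⟩ := hxU.exists_quadratic hγ hx1
  obtain ⟨k, hk1, hk2⟩ := exists_nat_pow_near hε1.le hx1
  have hxk : 0 < x ^ k := by positivity
  have heq : epsAbs γ = x ^ k := by
    by_contra hne
    have hlt : x ^ k < epsAbs γ := lt_of_le_of_ne hk1 (Ne.symm hne)
    have hz1 : 1 < epsAbs γ * (x ^ k)⁻¹ := by
      rw [← div_eq_mul_inv, one_lt_div hxk]; exact hlt
    have hzx : epsAbs γ * (x ^ k)⁻¹ < x := by
      rw [← div_eq_mul_inv, div_lt_iff₀ hxk, mul_comm, ← pow_succ]; exact hk2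
    have := hmin ⟨hεU.mul (hxU.pow k).inv, hz1, hzx.trans hxε⟩ hzx.le
    linarith
  refine ⟨x, s, e, k, hx1, he, hq, ?_, heq⟩
  by_contra! hk
  interval_cases k
  · simp at heq; linarith
  · simp at heq; linarith

lemma abs_entry_le {γ : SL2Z} {T : ℝ} (h : frobNorm γ ≤ T) (i j : Fin 2) :
    |(γ i j : ℝ)| ≤ T := by
  refine le_trans (Real.abs_le_sqrt ?_) h
  push_cast
  fin_cases i <;> fin_cases j <;> simp <;>
    nlinarith [sq_nonneg (γ 0 0 : ℝ), sq_nonneg (γ 0 1 : ℝ), sq_nonneg (γ 1 0 : ℝ),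
      sq_nonneg (γ 1 1 : ℝ)]

lemma abs_trZ_le {γ : SL2Z} {T : ℝ} (h : frobNorm γ ≤ T) : |(trZ γ : ℝ)| ≤ 2 * T := by
  have h1 := abs_entry_le h 0 0
  have h2 := abs_entry_le h 1 1
  rw [trZ]
  push_cast
  linarith [abs_add_le (γ 0 0 : ℝ) (γ 1 1 : ℝ)]

/-- The matrix is hyperbolic and its large eigenvalue is the fundamental unit. -/
def IsFund (γ : SL2Z) : Prop := 2 < |trZ γ| ∧ ¬NotFund γ

/-- A finite set of integers containing the traces of all non-fundamental elements of `Γ_T`. -/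
def exceptionalTraces (T : ℝ) : Finset ℤ :=
  Finset.Icc (-2) 2 ∪
    ((Finset.Icc (0 : ℤ) ⌊4 * √T⌋ ×ˢ ({1, -1} : Finset ℤ)) ×ˢ
      (Finset.range (⌊4 * Real.log (2 * T)⌋₊ + 1) ×ˢ ({1, -1} : Finset ℤ))).image
      fun p => p.2.2 * round (quadUnit p.1.1 p.1.2 ^ p.2.1 + (quadUnit p.1.1 p.1.2 ^ p.2.1)⁻¹)

lemma trZ_mem_exceptionalTraces {γ : SL2Z} {T : ℝ} (hT : 2 ≤ T) (hγT : frobNorm γ ≤ T)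
    (hγ : ¬IsFund γ) : trZ γ ∈ exceptionalTraces T := by
  rw [exceptionalTraces, Finset.mem_union]
  by_cases ht : 2 < |trZ γ|
  swap
  · left
    rw [Finset.mem_Icc, ← abs_le]
    omega
  right
  have hnf : NotFund γ := by by_contra h; exact hγ ⟨ht, h⟩
  obtain ⟨x, s, e, k, hx1, he, hq, hk, heq⟩ := hnf.exists_pow ht
  obtain ⟨hε1, hεt⟩ := epsAbs_facts ht
  obtain ⟨hx2, hs0, hs⟩ := quadratic_unit_bounds hx1 he hq
  have hεT : x ^ k ≤ 2 * T := by
    rw [← heq]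
    have : 0 < (epsAbs γ)⁻¹ := by positivity
    linarith [abs_trZ_le hγT]
  have hxT : x ≤ 2 * √T := by
    have h1 : x ^ 2 ≤ 2 * T := (pow_le_pow_right₀ hx1.le hk).trans hεT
    have h2 : √T ^ 2 = T := Real.sq_sqrt (by linarith)
    refine le_of_sq_le_sq ?_ (by positivity)
    nlinarith
  have hkT : k ≤ ⌊4 * Real.log (2 * T)⌋₊ := by
    refine Nat.le_floor ?_
    have h1 : (2 : ℝ) ^ k ≤ (2 * T) ^ 2 := by
      calc (2 : ℝ) ^ k ≤ (x ^ 2) ^ k := pow_le_pow_left₀ (by norm_num) hx2.le k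
        _ = (x ^ k) ^ 2 := by rw [← pow_mul, ← pow_mul, mul_comm]
        _ ≤ (2 * T) ^ 2 := pow_le_pow_left₀ (by positivity) hεT 2
    have h2 := Real.log_le_log (by positivity) h1
    rw [Real.log_pow, Real.log_pow] at h2
    have h3 := Real.log_two_gt_d9
    push_cast at h2
    nlinarith [(Nat.cast_nonneg k : (0 : ℝ) ≤ k)]
  have hround : round (x ^ k + (x ^ k)⁻¹) = |trZ γ| := by
    rw [← heq, hεt, ← Int.cast_abs, round_intCast]
  rw [Finset.mem_image]
  have hs' : s ≤ ⌊4 * √T⌋ := Int.le_floor.2 (by linarith)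
  rcases abs_choice (trZ γ) with h | h
  · refine ⟨((s, e), (k, 1)), ?_, ?_⟩
    · simp [hs0, hs', he]; omega
    · simp only [← eq_quadUnit hx1 he hq, hround, h]; ring
  · refine ⟨((s, e), (k, -1)), ?_, ?_⟩
    · simp [hs0, hs', he]; omega
    · simp only [← eq_quadUnit hx1 he hq, hround, h]; ring

lemma card_exceptionalTraces_le {δ : ℝ} (hδ : 0 < δ) :
    ∃ C : ℝ, 0 < C ∧ ∀ T : ℝ, 2 ≤ T →
      ((exceptionalTraces T).card : ℝ) ≤ C * T ^ ((1 : ℝ) / 2 + δ) := by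
  refine ⟨105 * (2 ^ δ / δ), by positivity, fun T hT => ?_⟩
  have hcard : (exceptionalTraces T).card ≤
      5 + ((⌊4 * √T⌋ + 1).toNat * 2) * ((⌊4 * Real.log (2 * T)⌋₊ + 1) * 2) := by
    refine (Finset.card_union_le _ _).trans (add_le_add (by simp) ?_)
    refine Finset.card_image_le.trans ?_
    simp [Finset.card_product]
  have hsq : 1 ≤ √T := Real.one_le_sqrt.2 (by linarith)
  have hlog : 1 ≤ Real.log (2 * T) := by
    have : Real.log (2 * 2) ≤ Real.log (2 * T) := Real.log_le_log (by norm_num) (by linarith)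
    rw [Real.log_mul (by norm_num) (by norm_num)] at this
    linarith [Real.log_two_gt_d9]
  have hA : (((⌊4 * √T⌋ + 1).toNat : ℕ) : ℝ) ≤ 5 * √T := by
    have h0 : 0 ≤ ⌊4 * √T⌋ + 1 := by
      have := Int.floor_nonneg.2 (by positivity : 0 ≤ 4 * √T)
      omega
    have h1 : (((⌊4 * √T⌋ + 1).toNat : ℤ) : ℝ) = ⌊4 * √T⌋ + 1 := by
      rw [Int.toNat_of_nonneg h0]; push_cast; rfl
    rw [Int.cast_natCast] at h1
    linarith [Int.floor_le (4 * √T)]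
  have hB : ((⌊4 * Real.log (2 * T)⌋₊ : ℕ) : ℝ) + 1 ≤ 5 * Real.log (2 * T) := by
    linarith [Nat.floor_le (by positivity : 0 ≤ 4 * Real.log (2 * T))]
  have hL : Real.log (2 * T) ≤ 2 ^ δ / δ * T ^ δ := by
    have := Real.log_le_rpow_div (by linarith : 0 ≤ 2 * T) hδ
    rw [Real.mul_rpow (by norm_num) (by linarith)] at this
    linarith [mul_div_right_comm ((2 : ℝ) ^ δ) (T ^ δ) δ]
  calc ((exceptionalTraces T).card : ℝ)
      ≤ 5 + (((⌊4 * √T⌋ + 1).toNat : ℕ) * 2 : ℝ) *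
          ((((⌊4 * Real.log (2 * T)⌋₊ : ℕ) : ℝ) + 1) * 2) := by exact_mod_cast hcard
    _ ≤ 5 + (5 * √T * 2) * (5 * Real.log (2 * T) * 2) := by gcongr
    _ ≤ 105 * (√T * Real.log (2 * T)) := by nlinarith
    _ ≤ 105 * (√T * (2 ^ δ / δ * T ^ δ)) := by gcongr
    _ = 105 * (2 ^ δ / δ) * T ^ ((1 : ℝ) / 2 + δ) := by
      rw [Real.rpow_add (by linarith), Real.sqrt_eq_rpow]; ring

/-- The divisor bound: `d(n) ≪ n^δ`. -/
lemma card_divisors_le_rpow {δ : ℝ} (hδ : 0 < δ) :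
    ∃ C : ℝ, 0 < C ∧ ∀ n : ℕ, n ≠ 0 → (n.divisors.card : ℝ) ≤ C * (n : ℝ) ^ δ := by
  set K : ℝ := max 1 (1 / (δ * Real.log 2)) with hK
  set M : ℕ := ⌈(2 : ℝ) ^ (1 / δ)⌉₊ with hM
  have hlog : 0 < Real.log 2 := Real.log_pos (by norm_num)
  have hK1 : 1 ≤ K := le_max_left _ _
  have hK2 : 1 ≤ K * (δ * Real.log 2) := by
    have h := le_max_right 1 (1 / (δ * Real.log 2))
    rwa [← hK, div_le_iff₀ (by positivity)] at h
  have hpow (p v : ℕ) : ((p : ℝ) ^ v) ^ δ = ((p : ℝ) ^ δ) ^ v := by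
    rw [← Real.rpow_natCast, ← Real.rpow_natCast, ← Real.rpow_mul (by positivity),
      ← Real.rpow_mul (by positivity), mul_comm]
  have hlarge (p v : ℕ) (hp : M ≤ p) : (v : ℝ) + 1 ≤ ((p : ℝ) ^ v) ^ δ := by
    have h2 : (2 : ℝ) ≤ (p : ℝ) ^ δ := by
      have h3 : (2 : ℝ) ^ (1 / δ) ≤ p := (Nat.le_ceil _).trans (by exact_mod_cast hp)
      have h4 := Real.rpow_le_rpow (by positivity) h3 hδ.le
      rwa [← Real.rpow_mul (by norm_num), one_div_mul_cancel hδ.ne', Real.rpow_one] at h4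
    rw [hpow]
    calc (v : ℝ) + 1 ≤ 2 ^ v := by exact_mod_cast Nat.lt_two_pow_self
      _ ≤ _ := pow_le_pow_left₀ (by norm_num) h2 v
  have hsmall (p v : ℕ) (hp : 2 ≤ p) : (v : ℝ) + 1 ≤ K * ((p : ℝ) ^ v) ^ δ := by
    have h2 : (2 : ℝ) ^ δ ≤ (p : ℝ) ^ δ :=
      Real.rpow_le_rpow (by norm_num) (by exact_mod_cast hp) hδ.le
    have h3 : 1 + v * (δ * Real.log 2) ≤ ((p : ℝ) ^ v) ^ δ := by
      rw [hpow]
      calc 1 + v * (δ * Real.log 2) ≤ Real.exp (v * (δ * Real.log 2)) := by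
            linarith [Real.add_one_le_exp (v * (δ * Real.log 2))]
        _ = ((2 : ℝ) ^ δ) ^ v := by
            rw [Real.exp_nat_mul, Real.rpow_def_of_pos (by norm_num), mul_comm δ]
        _ ≤ _ := pow_le_pow_left₀ (by positivity) h2 v
    have h4 : (v : ℝ) + 1 ≤ K * (1 + v * (δ * Real.log 2)) := by
      have : (v : ℝ) * 1 ≤ v * (K * (δ * Real.log 2)) := by gcongr
      linarith
    exact h4.trans (by gcongr)
  refine ⟨K ^ M, by positivity, fun n hn => ?_⟩
  calc (n.divisors.card : ℝ)
      = ∏ p ∈ n.primeFactors, ((n.factorization p : ℝ) + 1) := by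
        rw [Nat.card_divisors hn]; push_cast; rfl
    _ ≤ ∏ p ∈ n.primeFactors,
          ((if p < M then K else 1) * ((p : ℝ) ^ n.factorization p) ^ δ) := by
        refine Finset.prod_le_prod (fun _ _ => by positivity) fun p hp => ?_
        split_ifs with h
        · exact hsmall p _ (Nat.prime_of_mem_primeFactors hp).two_le
        · rw [one_mul]; exact hlarge p _ (not_lt.1 h)
    _ = K ^ (n.primeFactors.filter (· < M)).card * (n : ℝ) ^ δ := by
        rw [Finset.prod_mul_distrib, Finset.prod_ite, Finset.prod_const, Finset.prod_const_one,
          mul_one, Real.finsetProd_rpow _ _ (fun _ _ => by positivity)]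
        congr 2
        have := Nat.prod_factorization_pow_eq_self hn
        rw [Finsupp.prod, Nat.support_factorization] at this
        conv_rhs => rw [← this]
        push_cast
        rfl
    _ ≤ K ^ M * (n : ℝ) ^ δ := by
        gcongr
        calc (n.primeFactors.filter (· < M)).card ≤ (Finset.range M).card :=
              Finset.card_le_card fun p hp => by
                rw [Finset.mem_range]; exact (Finset.mem_filter.1 hp).2
          _ = M := Finset.card_range M

/-- Factorisations of `n` into two integers of absolute value at most `M`. -/
def boxFactorizations (M n : ℤ) : Finset (ℤ × ℤ) :=
  (Finset.Icc (-M) M ×ˢ Finset.Icc (-M) M).filter fun p => p.1 * p.2 = n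

lemma card_boxFactorizations_le (M : ℤ) {n : ℤ} (hn : n ≠ 0) :
    (boxFactorizations M n).card ≤ 2 * n.natAbs.divisors.card := by
  have hsub : boxFactorizations M n ⊆ (n.natAbs.divisors ×ˢ ({1, -1} : Finset ℤ)).image
      fun p => (p.2 * (p.1 : ℤ), n / (p.2 * (p.1 : ℤ))) := by
    rintro ⟨b, c⟩ hbc
    obtain ⟨-, hbc⟩ := Finset.mem_filter.1 hbc
    dsimp only at hbc
    have hb : b ≠ 0 := by rintro rfl; simp at hbc; exact hn hbc.symm
    have hdiv : b.natAbs ∈ n.natAbs.divisors := by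
      rw [Nat.mem_divisors]
      exact ⟨Int.natAbs_dvd_natAbs.2 ⟨c, hbc.symm⟩, by simpa using hn⟩
    have hc : n / b = c := by rw [← hbc, Int.mul_ediv_cancel_left _ hb]
    rw [Finset.mem_image]
    rcases Int.natAbs_eq b with h | h
    · refine ⟨(b.natAbs, 1), by simp only [Finset.mem_product]; exact ⟨hdiv, by simp⟩, ?_⟩
      dsimp only
      rw [one_mul, ← h, hc]
    · refine ⟨(b.natAbs, -1), by simp only [Finset.mem_product]; exact ⟨hdiv, by simp⟩, ?_⟩
      dsimp only
      rw [neg_one_mul, ← h, hc]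
  refine (Finset.card_le_card hsub).trans (Finset.card_image_le.trans ?_)
  rw [Finset.card_product, mul_comm]
  rfl

lemma card_boxFactorizations_zero_le (M : ℤ) :
    (boxFactorizations M 0).card ≤ 2 * (Finset.Icc (-M) M).card := by
  have hsub : boxFactorizations M 0 ⊆
      (Finset.Icc (-M) M).image (fun b => (b, 0)) ∪ (Finset.Icc (-M) M).image (fun c => (0, c)) := by
    rintro ⟨b, c⟩ hbc
    obtain ⟨hmem, hbc⟩ := Finset.mem_filter.1 hbc
    obtain ⟨hb, hc⟩ := Finset.mem_product.1 hmem
    rw [Finset.mem_union, Finset.mem_image, Finset.mem_image]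
    rcases mul_eq_zero.1 hbc with h | h
    · exact Or.inr ⟨c, hc, by simpa using h.symm⟩
    · exact Or.inl ⟨b, hb, by simpa using h.symm⟩
  refine (Finset.card_le_card hsub).trans ((Finset.card_union_le _ _).trans ?_)
  rw [two_mul]
  exact add_le_add Finset.card_image_le Finset.card_image_le

/-- The triples `(a, b, c)` of entries of integral matrices of determinant one and trace `t`
all of whose entries have absolute value at most `M`. -/
def traceTriples (M t : ℤ) : Finset (Σ _ : ℤ, ℤ × ℤ) :=
  ((Finset.Icc (-M) M).filter fun a => t - a ∈ Finset.Icc (-M) M).sigma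
    fun a => boxFactorizations M (a * (t - a) - 1)

lemma entry_mem_Icc {γ : SL2Z} {T : ℝ} (h : frobNorm γ ≤ T) (i j : Fin 2) :
    γ i j ∈ Finset.Icc (-⌊T⌋) ⌊T⌋ := by
  rw [Finset.mem_Icc, ← abs_le, Int.le_floor, Int.cast_abs]
  exact abs_entry_le h i j

lemma det_eq_one (γ : SL2Z) : γ 0 0 * γ 1 1 - γ 0 1 * γ 1 0 = 1 := by
  rw [← Matrix.det_fin_two]; exact γ.det_coe

lemma card_le_card_traceTriples {T : ℝ} {t : ℤ} {A : Finset SL2Z}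
    (hA : ∀ γ ∈ A, frobNorm γ ≤ T ∧ trZ γ = t) : A.card ≤ (traceTriples ⌊T⌋ t).card := by
  refine Finset.card_le_card_of_injOn (fun γ => ⟨γ 0 0, γ 0 1, γ 1 0⟩) ?_ ?_
  · intro γ hγ
    obtain ⟨hT, ht⟩ := hA γ hγ
    have hd : t - γ 0 0 = γ 1 1 := by rw [← ht, trZ]; ring
    have hdet := det_eq_one γ
    simp only [traceTriples, boxFactorizations, Finset.coe_sigma, Set.mem_sigma_iff,
      Finset.mem_coe, Finset.mem_filter, Finset.mem_product, hd]
    exact ⟨⟨entry_mem_Icc hT 0 0, entry_mem_Icc hT 1 1⟩,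
      ⟨entry_mem_Icc hT 0 1, entry_mem_Icc hT 1 0⟩, by linarith⟩
  · intro γ hγ γ' hγ' heq
    have ht := (hA γ hγ).2
    have ht' := (hA γ' hγ').2
    simp only [Sigma.mk.injEq, heq_eq_eq, Prod.mk.injEq] at heq
    obtain ⟨h00, h01, h10⟩ := heq
    rw [trZ] at ht ht'
    ext i j
    fin_cases i <;> fin_cases j <;> simp <;> omega

lemma card_traceTriples_le {δ : ℝ} (hδ : 0 < δ) :
    ∃ C : ℝ, 0 < C ∧ ∀ T : ℝ, 2 ≤ T → ∀ t : ℤ,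
      ((traceTriples ⌊T⌋ t).card : ℝ) ≤ C * T ^ (1 + δ) := by
  obtain ⟨C, hC, hdiv⟩ := card_divisors_le_rpow (half_pos hδ)
  refine ⟨6 * C * 2 ^ (δ / 2) + 12, by positivity, fun T hT t => ?_⟩
  set M := ⌊T⌋ with hM
  have hMT : (M : ℝ) ≤ T := Int.floor_le T
  have hM0 : 0 ≤ M := Int.floor_nonneg.2 (by linarith)
  have hbox : ((Finset.Icc (-M) M).card : ℝ) ≤ 3 * T := by
    have : (((Finset.Icc (-M) M).card : ℤ) : ℝ) = 2 * M + 1 := by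
      rw [Int.card_Icc, Int.toNat_of_nonneg (by omega)]; push_cast; ring
    rw [Int.cast_natCast] at this
    linarith
  have hterm (a : ℤ) (ha : a ∈ (Finset.Icc (-M) M).filter fun a => t - a ∈ Finset.Icc (-M) M) :
      ((boxFactorizations M (a * (t - a) - 1)).card : ℝ) ≤
        2 * (C * (2 * T ^ 2) ^ (δ / 2)) +
          if a ∈ ({1, -1} : Finset ℤ) then 2 * (3 * T) else 0 := by
    obtain ⟨ha, hta⟩ := Finset.mem_filter.1 ha
    by_cases hn : a * (t - a) - 1 = 0
    · have ha1 : a ∈ ({1, -1} : Finset ℤ) := by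
        have := Int.eq_one_or_neg_one_of_mul_eq_one (sub_eq_zero.1 hn)
        simpa using this
      rw [if_pos ha1, hn]
      have h0 : 0 ≤ 2 * (C * (2 * T ^ 2) ^ (δ / 2)) := by positivity
      have h1 : ((boxFactorizations M 0).card : ℝ) ≤ 2 * (Finset.Icc (-M) M).card := by
        exact_mod_cast card_boxFactorizations_zero_le M
      linarith
    · have h1 : ((boxFactorizations M (a * (t - a) - 1)).card : ℝ) ≤
          2 * ((a * (t - a) - 1).natAbs.divisors.card : ℝ) := by
        exact_mod_cast card_boxFactorizations_le M hn
      have h2 := hdiv (a * (t - a) - 1).natAbs (by simpa using hn)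
      have h3 : (((a * (t - a) - 1).natAbs : ℕ) : ℝ) ≤ 2 * T ^ 2 := by
        rw [Nat.cast_natAbs, Int.cast_abs]
        rw [Finset.mem_Icc, ← abs_le] at ha hta
        have ha' : |(a : ℝ)| ≤ T := le_trans (by exact_mod_cast ha) hMT
        have hta' : |((t - a : ℤ) : ℝ)| ≤ T := le_trans (by exact_mod_cast hta) hMT
        have h4 : |(a : ℝ) * ((t - a : ℤ) : ℝ)| ≤ T * T := by
          rw [abs_mul]; gcongr
        push_cast at h4 ⊢
        have h5 := abs_sub ((a : ℝ) * (t - a)) 1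
        rw [abs_one] at h5
        nlinarith
      have h4 : (((a * (t - a) - 1).natAbs : ℕ) : ℝ) ^ (δ / 2) ≤ (2 * T ^ 2) ^ (δ / 2) :=
        Real.rpow_le_rpow (by positivity) h3 (by positivity)
      have h5 : (0 : ℝ) ≤ if a ∈ ({1, -1} : Finset ℤ) then 2 * (3 * T) else 0 := by
        split_ifs <;> positivity
      have h6 : C * (((a * (t - a) - 1).natAbs : ℕ) : ℝ) ^ (δ / 2) ≤
          C * (2 * T ^ 2) ^ (δ / 2) := by gcongr
      linarith
  have hsum : ∑ a ∈ (Finset.Icc (-M) M).filter (fun a => t - a ∈ Finset.Icc (-M) M),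
      (if a ∈ ({1, -1} : Finset ℤ) then 2 * (3 * T) else 0) ≤ 12 * T := by
    rw [← Finset.sum_filter, Finset.sum_const, nsmul_eq_mul]
    have : ((((Finset.Icc (-M) M).filter fun a => t - a ∈ Finset.Icc (-M) M).filter
        fun a => a ∈ ({1, -1} : Finset ℤ)).card : ℝ) ≤ 2 := by
      have h : _ ≤ ({1, -1} : Finset ℤ).card := Finset.card_le_card
        (fun a ha => (Finset.mem_filter.1 ha).2 :
          (((Finset.Icc (-M) M).filter fun a => t - a ∈ Finset.Icc (-M) M).filter
            fun a => a ∈ ({1, -1} : Finset ℤ)) ⊆ {1, -1})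
      exact_mod_cast h
    nlinarith
  have hTδ : (2 * T ^ 2) ^ (δ / 2) = 2 ^ (δ / 2) * T ^ δ := by
    rw [Real.mul_rpow (by norm_num) (by positivity), ← Real.rpow_natCast T 2,
      ← Real.rpow_mul (by linarith)]
    congr 2
    push_cast
    ring
  have hT1 : 1 ≤ T ^ δ := Real.one_le_rpow (by linarith) hδ.le
  calc ((traceTriples M t).card : ℝ)
      = ∑ a ∈ (Finset.Icc (-M) M).filter (fun a => t - a ∈ Finset.Icc (-M) M),
          ((boxFactorizations M (a * (t - a) - 1)).card : ℝ) := by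
        rw [traceTriples, Finset.card_sigma]; push_cast; rfl
    _ ≤ _ := Finset.sum_le_sum hterm
    _ ≤ 3 * T * (2 * (C * (2 * T ^ 2) ^ (δ / 2))) + 12 * T := by
        rw [Finset.sum_add_distrib, Finset.sum_const, nsmul_eq_mul]
        refine add_le_add ?_ hsum
        gcongr
        exact le_trans (by exact_mod_cast Finset.card_filter_le _ _) hbox
    _ ≤ (6 * C * 2 ^ (δ / 2) + 12) * (T * T ^ δ) := by
        rw [hTδ]
        nlinarith
    _ = _ := by rw [Real.rpow_add (by linarith), Real.rpow_one]

lemma sum_inv_sq_le (N : ℕ) : ∑ g ∈ Finset.Icc 2 N, (1 : ℝ) / (g : ℝ) ^ 2 ≤ 3 / 4 := by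
  rcases lt_or_ge N 2 with h | h
  · rw [Finset.Icc_eq_empty (by omega)]; norm_num
  have : ∑ g ∈ Finset.Icc 2 N, (1 : ℝ) / (g : ℝ) ^ 2 ≤ 3 / 4 - (1 / N - 0) := by
    induction N, h using Nat.le_induction with
    | base => norm_num
    | succ n hn ih =>
      rw [Finset.sum_Icc_succ_top (by omega)]
      have hn0 : (0 : ℝ) < n := by positivity
      have : (1 : ℝ) / ((n + 1 : ℕ) : ℝ) ^ 2 ≤ 1 / n - 1 / ((n + 1 : ℕ) : ℝ) := by
        push_cast
        rw [div_sub_div _ _ (by positivity) (by positivity),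
          div_le_div_iff₀ (by positivity) (by positivity)]
        nlinarith
      linarith
  have h0 : (0 : ℝ) ≤ 1 / N := by positivity
  linarith

/-- Coprime pairs in `[1, N]²`. -/
def coprimePairs (N : ℕ) : Finset (ℕ × ℕ) :=
  (Finset.Icc 1 N ×ˢ Finset.Icc 1 N).filter fun p => p.1.Coprime p.2

lemma le_card_coprimePairs (N : ℕ) : (N : ℝ) ^ 2 / 4 ≤ ((coprimePairs N).card : ℝ) := by
  have hsub : (Finset.Icc 1 N ×ˢ Finset.Icc 1 N).filter (fun p => ¬p.1.Coprime p.2) ⊆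
      (Finset.Icc 2 N).biUnion fun g =>
        (Finset.Icc 1 (N / g) ×ˢ Finset.Icc 1 (N / g)).image fun p => (g * p.1, g * p.2) := by
    rintro ⟨a, b⟩ hab
    simp only [Finset.mem_filter, Finset.mem_product, Finset.mem_Icc] at hab
    obtain ⟨⟨⟨ha1, haN⟩, hb1, hbN⟩, hg⟩ := hab
    have hgpos : 0 < a.gcd b := Nat.gcd_pos_of_pos_left b ha1
    have hga := Nat.gcd_dvd_left a b
    have hgb := Nat.gcd_dvd_right a b
    have hg1 : a.gcd b ≠ 1 := hg
    rw [Finset.mem_biUnion]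
    refine ⟨a.gcd b, Finset.mem_Icc.2 ⟨by omega, (Nat.le_of_dvd ha1 hga).trans haN⟩, ?_⟩
    rw [Finset.mem_image]
    refine ⟨(a / a.gcd b, b / a.gcd b), ?_, ?_⟩
    · simp only [Finset.mem_product, Finset.mem_Icc]
      exact ⟨⟨Nat.div_pos (Nat.le_of_dvd ha1 hga) hgpos, Nat.div_le_div_right haN⟩,
        Nat.div_pos (Nat.le_of_dvd hb1 hgb) hgpos, Nat.div_le_div_right hbN⟩
    · simp only [Nat.mul_div_cancel' hga, Nat.mul_div_cancel' hgb]
  have hcard : ((Finset.Icc 1 N ×ˢ Finset.Icc 1 N).filter (fun p => ¬p.1.Coprime p.2)).card ≤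
      ∑ g ∈ Finset.Icc 2 N, (N / g) * (N / g) := by
    refine (Finset.card_le_card hsub).trans (Finset.card_biUnion_le.trans ?_)
    refine Finset.sum_le_sum fun g _ => Finset.card_image_le.trans ?_
    simp [Finset.card_product]
  have hreal : (((Finset.Icc 1 N ×ˢ Finset.Icc 1 N).filter
      (fun p => ¬p.1.Coprime p.2)).card : ℝ) ≤ (N : ℝ) ^ 2 * (3 / 4) := by
    calc _ ≤ ((∑ g ∈ Finset.Icc 2 N, (N / g) * (N / g) : ℕ) : ℝ) := by exact_mod_cast hcard
      _ ≤ ∑ g ∈ Finset.Icc 2 N, (N : ℝ) ^ 2 * (1 / (g : ℝ) ^ 2) := by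
          push_cast
          refine Finset.sum_le_sum fun g _ => ?_
          have h : ((N / g : ℕ) : ℝ) ≤ N / g := Nat.cast_div_le
          calc ((N / g : ℕ) : ℝ) * ((N / g : ℕ) : ℝ) ≤ (N / g) * (N / g) := by gcongr
            _ = _ := by ring
      _ = (N : ℝ) ^ 2 * ∑ g ∈ Finset.Icc 2 N, 1 / (g : ℝ) ^ 2 := by rw [Finset.mul_sum]
      _ ≤ _ := by gcongr; exact sum_inv_sq_le N
  have htotal := Finset.card_filter_add_card_filter_not
    (s := Finset.Icc 1 N ×ˢ Finset.Icc 1 N) (fun p => p.1.Coprime p.2)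
  have htotal' : ((coprimePairs N).card : ℝ) + ((Finset.Icc 1 N ×ˢ Finset.Icc 1 N).filter
      (fun p => ¬p.1.Coprime p.2)).card = (N : ℝ) ^ 2 := by
    rw [coprimePairs]
    have : (Finset.Icc 1 N ×ˢ Finset.Icc 1 N).card = N ^ 2 := by
      simp [Finset.card_product, sq]
    exact_mod_cast htotal.trans this
  linarith

/-- A coprime pair is the first row of a matrix in `SL(2, ℤ)` whose other entries are
no larger. -/
lemma exists_SL2Z_of_coprime {a b N : ℕ} (ha : 1 ≤ a) (hb : 1 ≤ b) (haN : a ≤ N) (hbN : b ≤ N)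
    (hab : a.Coprime b) :
    ∃ γ : SL2Z, γ 0 0 = a ∧ γ 0 1 = b ∧ |γ 1 0| ≤ N ∧ |γ 1 1| ≤ N := by
  have hbez : (a : ℤ) * a.gcdA b + b * a.gcdB b = 1 := by
    rw [← Nat.gcd_eq_gcd_ab, hab.gcd_eq_one]; rfl
  set u := a.gcdA b
  set v := a.gcdB b
  have hdiv := Int.mul_ediv_add_emod u b
  set d := u % (b : ℤ) with hd
  set c := -(v + a * (u / b)) with hc
  have hd0 : 0 ≤ d := Int.emod_nonneg _ (by omega)
  have hdb : d < b := Int.emod_lt_of_pos _ (by omega)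
  have hdet : (a : ℤ) * d - b * c = 1 := by
    rw [hc, ← hbez]
    linear_combination (a : ℤ) * hdiv
  have ha' : (1 : ℤ) ≤ a := by exact_mod_cast ha
  have hb' : (1 : ℤ) ≤ b := by exact_mod_cast hb
  have hcu : c ≤ a := by
    by_contra! h
    nlinarith
  have hcl : -1 ≤ c := by
    by_contra! h
    nlinarith
  refine ⟨⟨!![(a : ℤ), b; c, d], by rw [Matrix.det_fin_two_of]; exact hdet⟩, rfl, rfl, ?_, ?_⟩
  · change |c| ≤ N
    rw [abs_le]
    constructor <;> omega
  · change |d| ≤ N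
    rw [abs_le]
    constructor <;> omega

lemma finite_frobNorm_le (T : ℝ) : {γ : SL2Z | frobNorm γ ≤ T}.Finite := by
  let M := ⌊T⌋
  refine Set.Finite.of_finite_image (f := fun γ : SL2Z => fun i j => γ i j) ?_ ?_
  · refine (Set.Finite.pi' fun _ => Set.Finite.pi' fun _ => Set.finite_Icc (-M) M).subset ?_
    rintro _ ⟨γ, hγ, rfl⟩ i j
    simpa using entry_mem_Icc hγ i j
  · intro γ _ γ' _ h
    ext i j
    exact congrFun (congrFun h i) j

/-- The set `Γ_T`. -/
def normBall (T : ℝ) : Finset SL2Z := (finite_frobNorm_le T).toFinset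

lemma mem_normBall {T : ℝ} {γ : SL2Z} : γ ∈ normBall T ↔ frobNorm γ ≤ T := by
  simp [normBall]

lemma le_card_normBall {T : ℝ} (hT : 2 ≤ T) : T ^ 2 / 64 ≤ ((normBall T).card : ℝ) := by
  set N := ⌊T / 2⌋₊ with hN
  have hNT : (N : ℝ) ≤ T / 2 := Nat.floor_le (by linarith)
  have hN1 : (1 : ℝ) ≤ N := by
    have : 1 ≤ N := Nat.le_floor (by push_cast; linarith)
    exact_mod_cast this
  have hTN : T / 4 ≤ N := by linarith [Nat.lt_floor_add_one (T / 2)]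
  have hcard : (coprimePairs N).card ≤ (normBall T).card := by
    refine Finset.card_le_card_of_surjOn (fun γ => ((γ 0 0).toNat, (γ 0 1).toNat)) ?_
    rintro ⟨a, b⟩ hab
    simp only [coprimePairs, Finset.mem_coe, Finset.mem_filter, Finset.mem_product,
      Finset.mem_Icc] at hab
    obtain ⟨⟨⟨ha1, haN⟩, hb1, hbN⟩, hcop⟩ := hab
    obtain ⟨γ, h00, h01, h10, h11⟩ := exists_SL2Z_of_coprime ha1 hb1 haN hbN hcop
    refine ⟨γ, ?_, by simp [h00, h01]⟩
    rw [Finset.mem_coe, mem_normBall, frobNorm, Real.sqrt_le_left (by linarith)]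
    have e10 : γ 1 0 ^ 2 ≤ (N : ℤ) ^ 2 := sq_le_sq' (abs_le.1 h10).1 (abs_le.1 h10).2
    have e11 : γ 1 1 ^ 2 ≤ (N : ℤ) ^ 2 := sq_le_sq' (abs_le.1 h11).1 (abs_le.1 h11).2
    have e00 : γ 0 0 ^ 2 ≤ (N : ℤ) ^ 2 := by rw [h00]; exact_mod_cast Nat.pow_le_pow_left haN 2
    have e01 : γ 0 1 ^ 2 ≤ (N : ℤ) ^ 2 := by rw [h01]; exact_mod_cast Nat.pow_le_pow_left hbN 2
    have hle : γ 0 0 ^ 2 + γ 0 1 ^ 2 + γ 1 0 ^ 2 + γ 1 1 ^ 2 ≤ 4 * (N : ℤ) ^ 2 := by linarith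
    calc ((γ 0 0 ^ 2 + γ 0 1 ^ 2 + γ 1 0 ^ 2 + γ 1 1 ^ 2 : ℤ) : ℝ) ≤ 4 * (N : ℝ) ^ 2 := by
          exact_mod_cast hle
      _ ≤ T ^ 2 := by nlinarith
  calc T ^ 2 / 64 ≤ (N : ℝ) ^ 2 / 4 := by nlinarith
    _ ≤ ((coprimePairs N).card : ℝ) := le_card_coprimePairs N
    _ ≤ ((normBall T).card : ℝ) := by exact_mod_cast hcard

open Classical in
/-- The elements of `Γ_T` that are not hyperbolic or not fundamental. -/
def exceptionalElements (T : ℝ) : Finset SL2Z := (normBall T).filter fun γ => ¬IsFund γ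

lemma mem_exceptionalElements {T : ℝ} {γ : SL2Z} :
    γ ∈ exceptionalElements T ↔ frobNorm γ ≤ T ∧ ¬IsFund γ := by
  simp [exceptionalElements, mem_normBall]

lemma card_exceptionalElements_le {η : ℝ} (hη : 0 < η) :
    ∃ C : ℝ, 0 < C ∧ ∀ T : ℝ, 2 ≤ T →
      ((exceptionalElements T).card : ℝ) ≤ C * T ^ ((3 : ℝ) / 2 + η) := by
  obtain ⟨C₁, hC₁, h₁⟩ := card_exceptionalTraces_le (half_pos hη)
  obtain ⟨C₂, hC₂, h₂⟩ := card_traceTriples_le (half_pos hη)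
  refine ⟨C₁ * C₂, by positivity, fun T hT => ?_⟩
  have hmem : ∀ γ ∈ exceptionalElements T, frobNorm γ ≤ T ∧ ¬IsFund γ :=
    fun _ => mem_exceptionalElements.1
  have hfib : (exceptionalElements T).card =
      ∑ t ∈ exceptionalTraces T, ((exceptionalElements T).filter fun γ => trZ γ = t).card :=
    Finset.card_eq_sum_card_fiberwise fun γ hγ =>
      trZ_mem_exceptionalTraces hT (hmem γ hγ).1 (hmem γ hγ).2
  calc ((exceptionalElements T).card : ℝ)
      = ∑ t ∈ exceptionalTraces T,
          (((exceptionalElements T).filter fun γ => trZ γ = t).card : ℝ) := by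
        rw [hfib]; push_cast; rfl
    _ ≤ ∑ _t ∈ exceptionalTraces T, C₂ * T ^ (1 + η / 2) := by
        refine Finset.sum_le_sum fun t _ => le_trans ?_ (h₂ T hT t)
        have := card_le_card_traceTriples (T := T) (t := t)
          (A := (exceptionalElements T).filter fun γ => trZ γ = t) fun γ hγ => by
            obtain ⟨hγ, ht⟩ := Finset.mem_filter.1 hγ
            exact ⟨(hmem γ hγ).1, ht⟩
        exact_mod_cast this
    _ = (exceptionalTraces T).card * (C₂ * T ^ (1 + η / 2)) := by
        rw [Finset.sum_const, nsmul_eq_mul]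
    _ ≤ C₁ * T ^ ((1 : ℝ) / 2 + η / 2) * (C₂ * T ^ (1 + η / 2)) := by
        gcongr; exact h₁ T hT
    _ = C₁ * C₂ * T ^ ((3 : ℝ) / 2 + η) := by
        rw [mul_mul_mul_comm, ← Real.rpow_add (by linarith)]
        congr 2
        ring

/-- For every `η > 0` there is `C > 0` such that for all `T ≥ 2`, the number of
hyperbolic `γ ∈ Γ_T` for which `|ε_γ|` is not the fundamental unit is at most
`C·T^(3/2+η)`; equivalently `ℙ_T(|Tr γ| > 2 ∧ |ε_γ| = ε_K) = 1 - O(T^(-1/2+η))`. -/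
theorem statement6 (η : ℝ) (hη : 0 < η) :
    ∃ C : ℝ, 0 < C ∧ ∀ T : ℝ, 2 ≤ T →
      (Nat.card {γ : SL2Z // frobNorm γ ≤ T ∧ 2 < |trZ γ| ∧ NotFund γ} : ℝ) ≤
        C * T ^ ((3 : ℝ) / 2 + η) ∧
      |(Nat.card {γ : SL2Z // frobNorm γ ≤ T ∧ 2 < |trZ γ| ∧ ¬NotFund γ} : ℝ) /
          (Nat.card {γ : SL2Z // frobNorm γ ≤ T} : ℝ) - 1| ≤
        C * T ^ (-(1 : ℝ) / 2 + η) := by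
  classical
  obtain ⟨C, hC, hbad⟩ := card_exceptionalElements_le hη
  refine ⟨64 * C, by positivity, fun T hT => ?_⟩
  have hT0 : 0 < T := by linarith
  have hbadT := hbad T hT
  have hlow := le_card_normBall hT
  have hbad_nonneg : (0 : ℝ) ≤ (exceptionalElements T).card := Nat.cast_nonneg _
  have hall : Nat.card {γ : SL2Z // frobNorm γ ≤ T} = (normBall T).card :=
    Nat.subtype_card _ fun _ => mem_normBall
  have hnot : Nat.card {γ : SL2Z // frobNorm γ ≤ T ∧ 2 < |trZ γ| ∧ NotFund γ} ≤
      (exceptionalElements T).card := by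
    rw [Nat.subtype_card ((normBall T).filter fun γ => 2 < |trZ γ| ∧ NotFund γ)
      fun γ => by rw [Finset.mem_filter, mem_normBall]]
    refine Finset.card_le_card fun γ hγ => ?_
    rw [Finset.mem_filter] at hγ
    exact Finset.mem_filter.2 ⟨hγ.1, fun h => h.2 hγ.2.2⟩
  have hgood : Nat.card {γ : SL2Z // frobNorm γ ≤ T ∧ 2 < |trZ γ| ∧ ¬NotFund γ} =
      ((normBall T).filter IsFund).card :=
    Nat.subtype_card _ fun γ => by rw [Finset.mem_filter, mem_normBall, IsFund]
  have hsplit : (((normBall T).filter IsFund).card : ℝ) + (exceptionalElements T).card =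
      (normBall T).card := by
    have := Finset.card_filter_add_card_filter_not (s := normBall T) IsFund
    rw [exceptionalElements]
    exact_mod_cast this
  constructor
  · calc _ ≤ ((exceptionalElements T).card : ℝ) := by exact_mod_cast hnot
      _ ≤ C * T ^ ((3 : ℝ) / 2 + η) := hbadT
      _ ≤ 64 * C * T ^ ((3 : ℝ) / 2 + η) := by
        gcongr
        linarith
  · rw [hall, hgood]
    have hcard_pos : (0 : ℝ) < (normBall T).card := lt_of_lt_of_le (by positivity) hlow
    have heq : (((normBall T).filter IsFund).card : ℝ) / (normBall T).card - 1 =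
        -((exceptionalElements T).card / (normBall T).card) := by
      rw [← hsplit] at hcard_pos ⊢
      field_simp
      ring
    rw [heq, abs_neg, abs_of_nonneg (by positivity), div_le_iff₀ hcard_pos]
    calc ((exceptionalElements T).card : ℝ) ≤ C * T ^ ((3 : ℝ) / 2 + η) := hbadT
      _ = 64 * C * T ^ (-(1 : ℝ) / 2 + η) * (T ^ 2 / 64) := by
        rw [show (3 : ℝ) / 2 + η = (-(1 : ℝ) / 2 + η) + (2 : ℕ) by push_cast; ring,
          Real.rpow_add hT0, Real.rpow_natCast]
        ring
      _ ≤ _ := by gcongr
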